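/- arXiv:1905.04273 — 2 statements merged into one kernel-verified Lean document; each statement's English description precedes it below -/
import Mathlib

section
/- Fix ε, δ > 0, δ' ∈ (0,1), a restriction parameter Δ ≥ 1, integers k ≤ k̄ < d, and Δ-restricted-sensitivity neighboring histograms h, h' : Fin d → ℕ. Then for every set S of outcomes: Pr[ prEM_{k,k̄}(h, D_{k̄}(h)) ∈ S ] ≤ e^{ε'} · Pr[ prEM_{k,k̄}(h', D_{k̄}(h')) ∈ S ] + δ + δ', where ε' = min{ kε, kε·(e^{ε}−1)/(e^{ε}+1) + ε·√(2k·ln(1/δ')), kε²/2 + ε·√((k/2)·ln(1/δ')) }. (Equivalently, the limited-domain Gumbel-noise top-k mechanism of Algorithm 1 is (ε', δ + δ')-differentially private.) -/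
open scoped BigOperators

/-- The `k`-th largest value among the entries of the histogram `h`. -/
noncomputable def kthLargest {d : ℕ} (h : Fin d → ℕ) (k : ℕ) : ℕ :=
  sSup {v | k ≤ (Finset.univ.filter fun i => v ≤ h i).card}

/-- Histograms are neighboring if one user's data is added or removed. -/
def Neighbors {d : ℕ} (h h' : Fin d → ℕ) : Prop :=
  (∀ i, h' i ≤ h i ∧ h i ≤ h' i + 1) ∨ (∀ i, h i ≤ h' i ∧ h' i ≤ h i + 1)

/-- `Δ`-restricted-sensitivity neighbors. -/
def RestrictedNeighbors {d : ℕ} (Δ : ℕ) (h h' : Fin d → ℕ) : Prop :=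
  Neighbors h h' ∧ (Finset.univ.filter fun i => h i ≠ h' i).card ≤ Δ

/-- The rank of index `i` in the ordering of `h` by decreasing count, ties toward
smaller indices. -/
def histRank {d : ℕ} (h : Fin d → ℕ) (i : Fin d) : ℕ :=
  (Finset.univ.filter fun j => h i < h j ∨ (h j = h i ∧ j < i)).card

/-- The limited domain `D_k(h)`: the indices of the `k` largest entries of `h`. -/
def limitedDomain {d : ℕ} (h : Fin d → ℕ) (k : ℕ) : Finset (Fin d) :=
  Finset.univ.filter fun i => histRank h i < k

/-- The count `h_⊥ = h_{(k̄+1)} + 1 + ln(min{Δ,k̄}/δ)/ε` assigned to `⊥`. -/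
noncomputable def hBot {d : ℕ} (ε δ : ℝ) (Δ kbar : ℕ) (h : Fin d → ℕ) : ℝ :=
  (kthLargest h (kbar + 1) : ℝ) + 1 + Real.log ((min Δ kbar : ℕ) / δ) / ε

/-- Exponential-mechanism weight of an outcome in `Fin d ∪ {⊥}` (with `⊥ = none`). -/
noncomputable def emWeight {d : ℕ} (ε δ : ℝ) (Δ kbar : ℕ) (h : Fin d → ℕ) :
    Option (Fin d) → ℝ
  | some i => Real.exp (ε * (h i : ℝ))
  | none => Real.exp (ε * hBot ε δ Δ kbar h)

/-- The limited histogram exponential mechanism `ĥEM(h, D)`: probability of outcome `o`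
in `D ∪ {⊥}` proportional to its weight. -/
noncomputable def stepProb {d : ℕ} (ε δ : ℝ) (Δ kbar : ℕ) (h : Fin d → ℕ)
    (D : Finset (Fin d)) (o : Option (Fin d)) : ℝ :=
  emWeight ε δ Δ kbar h o /
    (emWeight ε δ Δ kbar h none + ∑ j ∈ D, emWeight ε δ Δ kbar h (some j))

/-- `prEMProb ε δ Δ kbar h k D l` is the probability that the peeling mechanism
`prEM_{k,k̄}(h, D)` outputs exactly the ordered list `l` (with `⊥ = none`). -/
noncomputable def prEMProb {d : ℕ} (ε δ : ℝ) (Δ kbar : ℕ) (h : Fin d → ℕ) :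
    ℕ → Finset (Fin d) → List (Option (Fin d)) → ℝ
  | 0, _, l => if l = [] then 1 else 0
  | _ + 1, D, [none] => stepProb ε δ Δ kbar h D none
  | k + 1, D, some i :: rest =>
      if i ∈ D then
        stepProb ε δ Δ kbar h D (some i) * prEMProb ε δ Δ kbar h k (D.erase i) rest
      else 0
  | _ + 1, _, _ => 0

theorem finite_hoeffding {ι : Type*} [Fintype ι] (p X : ι → ℝ) (hp : ∀ i, 0 ≤ p i)
    (hsum : ∑ i, p i = 1) {a b : ℝ} (hX : ∀ i, X i ∈ Set.Icc a b) (t : ℝ) :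
    ∑ i, p i * Real.exp (t * X i) ≤
      Real.exp (t * ∑ i, p i * X i + t ^ 2 * (b - a) ^ 2 / 8) := by
  let _ : MeasurableSpace ι := ⊤
  let m : PMF ι := PMF.ofFintype (fun i => ENNReal.ofReal (p i)) (by
    rw [← ENNReal.ofReal_sum_of_nonneg fun i _ => hp i, hsum, ENNReal.ofReal_one])
  have hint : ∀ f : ι → ℝ, ∫ i, f i ∂m.toMeasure = ∑ i, p i * f i := fun f => by
    simp [PMF.integral_eq_sum, m, ENNReal.toReal_ofReal (hp _)]
  have hmgf := (ProbabilityTheory.hasSubgaussianMGF_of_mem_Icc (μ := m.toMeasure) (X := X)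
    (measurable_from_top.aemeasurable) (Filter.Eventually.of_forall hX)).mgf_le t
  rw [ProbabilityTheory.mgf, hint, hint] at hmgf
  set μ := ∑ i, p i * X i
  have hexp : ∀ i, p i * Real.exp (t * X i) =
      Real.exp (t * μ) * (p i * Real.exp (t * (X i - μ))) := fun i => by
    rw [mul_left_comm, ← Real.exp_add]; ring_nf
  simp_rw [hexp, ← Finset.mul_sum]
  rw [Real.exp_add]
  refine mul_le_mul_of_nonneg_left (hmgf.trans (le_of_eq ?_)) (Real.exp_pos _).le
  congr 1
  simp only [NNReal.coe_pow, NNReal.coe_div, coe_nnnorm, Real.norm_eq_abs, NNReal.coe_ofNat,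
    div_pow, sq_abs]
  ring

theorem neg_log_le_chord {ε y : ℝ} (hε : 0 < ε)
    (hy : y ∈ Set.Icc (Real.exp (-ε)) (Real.exp ε)) :
    -Real.log y ≤ ε * ((Real.exp ε - 1) / (Real.exp ε + 1)) +
      2 * ε / (Real.exp ε - Real.exp (-ε)) * (1 - y) := by
  have hlt : Real.exp (-ε) < Real.exp ε := Real.exp_lt_exp.2 (by linarith)
  have hsub : 0 < Real.exp ε - Real.exp (-ε) := sub_pos.2 hlt
  have hne := hsub.ne'
  have hc := strictConcaveOn_log_Ioi.concaveOn.2 (Set.mem_Ioi.2 (Real.exp_pos (-ε)))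
    (Set.mem_Ioi.2 (Real.exp_pos ε))
    (div_nonneg (sub_nonneg.2 hy.2) hsub.le) (div_nonneg (sub_nonneg.2 hy.1) hsub.le)
    (by field_simp; ring)
  simp only [smul_eq_mul, Real.log_exp] at hc
  have hyy : (Real.exp ε - y) / (Real.exp ε - Real.exp (-ε)) * Real.exp (-ε) +
      (y - Real.exp (-ε)) / (Real.exp ε - Real.exp (-ε)) * Real.exp ε = y := by
    field_simp; ring
  rw [hyy] at hc
  have hchord : ε * ((Real.exp ε - 1) / (Real.exp ε + 1)) +
      2 * ε / (Real.exp ε - Real.exp (-ε)) * (1 - y) =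
      -((Real.exp ε - y) / (Real.exp ε - Real.exp (-ε)) * -ε +
        (y - Real.exp (-ε)) / (Real.exp ε - Real.exp (-ε)) * ε) := by
    have h1 : 1 < Real.exp ε := Real.one_lt_exp_iff.2 hε
    rw [Real.exp_neg] at hsub ⊢
    generalize Real.exp ε = E at *
    have h2 : E ≠ 0 := by positivity
    have h3 : E + 1 ≠ 0 := by positivity
    have h4 : E - 1 ≠ 0 := by linarith
    have h5 : E - E⁻¹ = (E - 1) * (E + 1) / E := by field_simp; ring
    rw [h5]
    field_simp
    ring
  linarith

theorem exp_sub_one_div_exp_add_one_le {ε : ℝ} (hε : 0 < ε) :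
    (Real.exp ε - 1) / (Real.exp ε + 1) ≤ ε / 2 := by
  have h := Real.le_log_one_add_of_nonneg (sub_nonneg.2 (Real.one_le_exp hε.le))
  rw [add_sub_cancel, Real.log_exp, mul_div_assoc] at h
  rw [show Real.exp ε - 1 + 2 = Real.exp ε + 1 by ring] at h
  linarith

/-- Moment bound for the privacy loss of a pair of finite distributions whose likelihood ratio
has range `exp ε`. -/
theorem sum_mul_rpow_ratio_le {ι : Type*} [Fintype ι] (p q : ι → ℝ) (hp : ∀ i, 0 < p i)
    (hq : ∀ i, 0 < q i) (hpsum : ∑ i, p i = 1) (hqsum : ∑ i, q i = 1) {ε r : ℝ} (hε : 0 < ε)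
    (hr : r ∈ Set.Icc (Real.exp (-ε)) 1) (hpq : ∀ i, r * q i ≤ p i ∧ p i ≤ r * Real.exp ε * q i)
    {t : ℝ} (ht : 0 ≤ t) :
    ∑ i, p i * (p i / q i) ^ t ≤
      Real.exp (t * (ε * ((Real.exp ε - 1) / (Real.exp ε + 1))) + t ^ 2 * ε ^ 2 / 8) := by
  have hr0 : 0 < r := (Real.exp_pos _).trans_le hr.1
  have hL : ∀ i, Real.log (p i / q i) ∈ Set.Icc (Real.log r) (Real.log r + ε) := fun i => by
    constructor
    · exact Real.log_le_log hr0 ((le_div_iff₀ (hq i)).2 (hpq i).1)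
    · have h := Real.log_le_log (div_pos (hp i) (hq i)) ((div_le_iff₀ (hq i)).2 (hpq i).2)
      rwa [Real.log_mul hr0.ne' (Real.exp_pos _).ne', Real.log_exp] at h
  have hmean : ∑ i, p i * Real.log (p i / q i) ≤
      ε * ((Real.exp ε - 1) / (Real.exp ε + 1)) := by
    have hchord : ∀ i, p i * Real.log (p i / q i) ≤
        ε * ((Real.exp ε - 1) / (Real.exp ε + 1)) * p i +
          2 * ε / (Real.exp ε - Real.exp (-ε)) * (p i - q i) := fun i => by
      have hy : q i / p i ∈ Set.Icc (Real.exp (-ε)) (Real.exp ε) := by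
        constructor
        · rw [le_div_iff₀ (hp i), Real.exp_neg, inv_mul_le_iff₀ (Real.exp_pos _)]
          refine (hpq i).2.trans (mul_le_mul_of_nonneg_right ?_ (hq i).le)
          exact mul_le_of_le_one_left (Real.exp_pos _).le hr.2
        · rw [div_le_iff₀ (hp i)]
          have h1 := mul_le_mul_of_nonneg_right hr.1 (hq i).le
          rw [Real.exp_neg, inv_mul_le_iff₀ (Real.exp_pos _)] at h1
          exact h1.trans (mul_le_mul_of_nonneg_left (hpq i).1 (Real.exp_pos _).le)
      have h1 := mul_le_mul_of_nonneg_left (neg_log_le_chord hε hy) (hp i).le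
      rw [← Real.log_inv, inv_div] at h1
      refine h1.trans (le_of_eq ?_)
      have := (hp i).ne'
      generalize (Real.exp ε - 1) / (Real.exp ε + 1) = A
      generalize 2 * ε / (Real.exp ε - Real.exp (-ε)) = B
      field_simp
    refine (Finset.sum_le_sum fun i _ => hchord i).trans (le_of_eq ?_)
    rw [Finset.sum_add_distrib, ← Finset.mul_sum, ← Finset.mul_sum, Finset.sum_sub_distrib,
      hpsum, hqsum]
    ring
  calc ∑ i, p i * (p i / q i) ^ t
      = ∑ i, p i * Real.exp (t * Real.log (p i / q i)) := by
        refine Finset.sum_congr rfl fun i _ => ?_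
        rw [Real.rpow_def_of_pos (div_pos (hp i) (hq i)), mul_comm t]
    _ ≤ _ := finite_hoeffding p _ (fun i => (hp i).le) hpsum hL t
    _ ≤ _ := by
        rw [add_sub_cancel_left]
        gcongr

/-- Probability that the exponential mechanism with outcome weights `c` on the domain
`D ∪ {⊥}` outputs `o`. -/
noncomputable def peelStep {d : ℕ} (c : Option (Fin d) → ℝ) (D : Finset (Fin d))
    (o : Option (Fin d)) : ℝ :=
  c o / (c none + ∑ j ∈ D, c (some j))

/-- Output distribution of the peeling mechanism with outcome weights `c`. -/
noncomputable def peelProb {d : ℕ} (c : Option (Fin d) → ℝ) :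
    ℕ → Finset (Fin d) → List (Option (Fin d)) → ℝ
  | 0, _, l => if l = [] then 1 else 0
  | _ + 1, D, [none] => peelStep c D none
  | k + 1, D, some i :: rest =>
      if i ∈ D then peelStep c D (some i) * peelProb c k (D.erase i) rest else 0
  | _ + 1, _, _ => 0

/-- A finite set of lists containing all outputs of a `k`-step peeling mechanism. -/
def peelOutcomes (d : ℕ) : ℕ → Finset (List (Option (Fin d)))
  | 0 => {[]}
  | k + 1 => insert [none] (Finset.univ.biUnion fun i : Fin d =>
      (peelOutcomes d k).image (some i :: ·))

section Peeling

variable {d : ℕ} {c c' : Option (Fin d) → ℝ}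

theorem prEMProb_eq_peelProb (ε δ : ℝ) (Δ kbar : ℕ) (h : Fin d → ℕ) (k : ℕ)
    (D : Finset (Fin d)) (l : List (Option (Fin d))) :
    prEMProb ε δ Δ kbar h k D l = peelProb (emWeight ε δ Δ kbar h) k D l := by
  induction k generalizing D l with
  | zero => simp [prEMProb, peelProb]
  | succ k ih =>
    rcases l with _ | ⟨_ | i, _ | ⟨o, l⟩⟩ <;> simp [prEMProb, peelProb, ih, stepProb, peelStep]

theorem sum_peelOutcomes_succ (k : ℕ) (F : List (Option (Fin d)) → ℝ) :
    ∑ l ∈ peelOutcomes d (k + 1), F l =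
      F [none] + ∑ i, ∑ l ∈ peelOutcomes d k, F (some i :: l) := by
  rw [peelOutcomes, Finset.sum_insert (by simp), Finset.sum_biUnion]
  · congr 1
    refine Finset.sum_congr rfl fun i _ => Finset.sum_image fun a _ b _ hab => ?_
    simpa using hab
  · intro i _ j _ hij
    rw [Function.onFun, Finset.disjoint_left]
    intro l hl hl'
    simp only [Finset.mem_image] at hl hl'
    obtain ⟨a, _, rfl⟩ := hl
    obtain ⟨b, _, hb⟩ := hl'
    simp_all

theorem peelProb_eq_zero_of_notMem {k : ℕ} {D : Finset (Fin d)} {l : List (Option (Fin d))}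
    (hl : l ∉ peelOutcomes d k) : peelProb c k D l = 0 := by
  induction k generalizing D l with
  | zero => simp_all [peelProb, peelOutcomes]
  | succ k ih =>
    rcases l with _ | ⟨_ | i, _ | ⟨o, l⟩⟩ <;> simp_all [peelProb, peelOutcomes]

theorem sum_peelOutcomes_succ_mul (k : ℕ) (D : Finset (Fin d))
    (F : List (Option (Fin d)) → ℝ) :
    ∑ l ∈ peelOutcomes d (k + 1), peelProb c (k + 1) D l * F l =
      peelStep c D none * F [none] + ∑ i ∈ D, peelStep c D (some i) *
        ∑ l ∈ peelOutcomes d k, peelProb c k (D.erase i) l * F (some i :: l) := by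
  rw [sum_peelOutcomes_succ]
  simp only [peelProb, ite_mul, zero_mul]
  congr 1
  rw [← Finset.sum_subset (Finset.subset_univ D)]
  · refine Finset.sum_congr rfl fun i hi => ?_
    simp only [hi, if_true, Finset.mul_sum, mul_assoc]
  · intro i _ hi
    simp [hi]

theorem peelStep_pos (hc : ∀ o, 0 < c o) (D : Finset (Fin d)) (o : Option (Fin d)) :
    0 < peelStep c D o :=
  div_pos (hc o) (add_pos_of_pos_of_nonneg (hc none) (Finset.sum_nonneg fun _ _ => (hc _).le))

theorem peelProb_nonneg (hc : ∀ o, 0 < c o) (k : ℕ) (D : Finset (Fin d))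
    (l : List (Option (Fin d))) : 0 ≤ peelProb c k D l := by
  induction k generalizing D l with
  | zero => rw [peelProb]; split <;> norm_num
  | succ k ih =>
    rcases l with _ | ⟨_ | i, _ | ⟨o, l⟩⟩ <;> simp only [peelProb, le_refl]
    · exact (peelStep_pos hc D none).le
    all_goals
      split
      · exact mul_nonneg (peelStep_pos hc D _).le (ih _ _)
      · exact le_rfl

theorem peelProb_eq_zero_of_eq_zero (hc' : ∀ o, 0 < c' o) {k : ℕ} {D : Finset (Fin d)}
    {l : List (Option (Fin d))} (hl : peelProb c' k D l = 0) : peelProb c k D l = 0 := by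
  induction k generalizing D l with
  | zero => simpa only [peelProb] using hl
  | succ k ih =>
    rcases l with _ | ⟨_ | i, _ | ⟨o, l⟩⟩ <;> simp only [peelProb] at hl ⊢
    · exact absurd hl (peelStep_pos hc' D none).ne'
    all_goals
      split at hl
      · rw [if_pos ‹_›, ih ((mul_eq_zero.1 hl).resolve_left (peelStep_pos hc' D _).ne'), mul_zero]
      · rw [if_neg ‹_›]

theorem peelStep_none_add_sum (hc : ∀ o, 0 < c o) (D : Finset (Fin d)) :
    peelStep c D none + ∑ i ∈ D, peelStep c D (some i) = 1 := by
  simp only [peelStep]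
  rw [← Finset.sum_div, ← add_div]
  exact div_self (add_pos_of_pos_of_nonneg (hc none) (Finset.sum_nonneg fun _ _ => (hc _).le)).ne'

theorem sum_peelProb (hc : ∀ o, 0 < c o) (k : ℕ) (D : Finset (Fin d)) :
    ∑ l ∈ peelOutcomes d k, peelProb c k D l = 1 := by
  induction k generalizing D with
  | zero => simp [peelOutcomes, peelProb]
  | succ k ih =>
    have h := sum_peelOutcomes_succ_mul (c := c) k D fun _ => 1
    simp only [mul_one, ih] at h
    rw [h, peelStep_none_add_sum hc]

theorem peelProb_comp_map_le (hc : ∀ o, 0 < c o) {σ : Fin d → Fin d} (k : ℕ)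
    {D : Finset (Fin d)} (hσ : Set.InjOn σ D) {l : List (Option (Fin d))}
    (hl : ∀ i ∈ D, some i ∈ l → σ i = i) :
    peelProb (c ∘ Option.map σ) k D l ≤ peelProb c k (D.image σ) l := by
  induction k generalizing D l with
  | zero => simp [peelProb]
  | succ k ih =>
    have hstep : ∀ o : Option (Fin d), o.map σ = o →
        peelStep (c ∘ Option.map σ) D o = peelStep c (D.image σ) o := fun o ho => by
      simp [peelStep, Finset.sum_image hσ, ho]
    have hcons : ∀ i l, (∀ j ∈ D, some j ∈ some i :: l → σ j = j) →
        peelProb (c ∘ Option.map σ) (k + 1) D (some i :: l) ≤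
          peelProb c (k + 1) (D.image σ) (some i :: l) := fun i l hl => by
      by_cases hiD : i ∈ D
      · have hi : σ i = i := hl i hiD (by simp)
        have himage : (D.erase i).image σ = (D.image σ).erase i := by
          ext j
          simp only [Finset.mem_image, Finset.mem_erase]
          constructor
          · rintro ⟨m, ⟨hmi, hm⟩, rfl⟩
            exact ⟨fun h => hmi (hσ hm hiD (h.trans hi.symm)), m, hm, rfl⟩
          · rintro ⟨hji, m, hm, rfl⟩
            exact ⟨m, ⟨fun h => hji (by rw [h, hi]), hm⟩, rfl⟩
        simp only [peelProb]
        rw [if_pos hiD, if_pos (Finset.mem_image.2 ⟨i, hiD, hi⟩), hstep _ (by simp [hi]), ← himage]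
        refine mul_le_mul_of_nonneg_left (ih (hσ.mono (by simp)) fun j hj hjl => ?_)
          (peelStep_pos hc _ _).le
        exact hl j (Finset.mem_of_mem_erase hj) (List.mem_cons_of_mem _ hjl)
      · refine le_of_eq_of_le ?_ (peelProb_nonneg hc _ _ _)
        simp only [peelProb, hiD, if_false]
    rcases l with _ | ⟨_ | i, _ | ⟨o, l⟩⟩
    · simp [peelProb]
    · simp only [peelProb]
      exact (hstep none rfl).le
    · simp [peelProb]
    all_goals exact hcons _ _ hl

/-- Outputs meeting a set `B` of low-weight indices are unlikely. -/
theorem sum_peelProb_mem_le (hc : ∀ o, 0 < c o) (k : ℕ) (D B : Finset (Fin d)) :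
    ∑ l ∈ (peelOutcomes d k).filter (fun l => ∃ i ∈ B, some i ∈ l), peelProb c k D l ≤
      (∑ i ∈ B, c (some i)) / c none := by
  have hBnn : 0 ≤ (∑ i ∈ B, c (some i)) / c none :=
    div_nonneg (Finset.sum_nonneg fun _ _ => (hc _).le) (hc _).le
  induction k generalizing D with
  | zero => simpa [peelOutcomes, Finset.sum_filter] using hBnn
  | succ k ih =>
    have hind := sum_peelOutcomes_succ_mul (c := c) k D
      (fun l => if ∃ i ∈ B, some i ∈ l then 1 else 0)
    simp only [mul_ite, mul_one, mul_zero, ← Finset.sum_filter] at hind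
    rw [hind]
    set W := (∑ i ∈ B, c (some i)) / c none with hW
    have hbranch : ∀ i, ∑ l ∈ (peelOutcomes d k).filter (fun l => ∃ j ∈ B, some j ∈ some i :: l),
        peelProb c k (D.erase i) l ≤ (if i ∈ B then 1 else 0) + W := fun i => by
      split_ifs with hi
      · refine le_add_of_le_of_nonneg ?_ hBnn
        rw [← sum_peelProb hc k (D.erase i)]
        exact Finset.sum_le_sum_of_subset_of_nonneg (Finset.filter_subset _ _)
          fun _ _ _ => peelProb_nonneg hc _ _ _
      · rw [zero_add]
        refine le_of_eq_of_le ?_ (ih (D.erase i))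
        congr 1
        refine Finset.filter_congr fun l _ => exists_congr fun j => and_congr_right fun hj => ?_
        have : j ≠ i := fun h => hi (h ▸ hj)
        simp [this]
    have hhit : ∑ i ∈ D, peelStep c D (some i) * (if i ∈ B then 1 else 0) ≤
        W * peelStep c D none := by
      simp only [mul_ite, mul_one, mul_zero, ← Finset.sum_filter, peelStep]
      rw [← Finset.sum_div, hW, div_mul_div_cancel₀ (hc none).ne']
      refine div_le_div_of_nonneg_right ?_
        (add_pos_of_pos_of_nonneg (hc none) (Finset.sum_nonneg fun _ _ => (hc _).le)).le
      exact Finset.sum_le_sum_of_subset_of_nonneg (fun i hi => (Finset.mem_filter.1 hi).2)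
        fun _ _ _ => (hc _).le
    have hnone : ¬ ∃ i ∈ B, some i ∈ ([none] : List (Option (Fin d))) := by simp
    rw [if_neg hnone, zero_add]
    calc _ ≤ ∑ i ∈ D, peelStep c D (some i) * ((if i ∈ B then 1 else 0) + W) :=
          Finset.sum_le_sum fun i _ =>
            mul_le_mul_of_nonneg_left (hbranch i) (peelStep_pos hc D _).le
      _ = ∑ i ∈ D, peelStep c D (some i) * (if i ∈ B then 1 else 0) +
            (∑ i ∈ D, peelStep c D (some i)) * W := by
          simp only [mul_add, Finset.sum_add_distrib, Finset.sum_mul]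
      _ ≤ W * (peelStep c D none + ∑ i ∈ D, peelStep c D (some i)) := by linarith
      _ = W := by rw [peelStep_none_add_sum hc, mul_one]

/-- The one-step likelihood ratios of the two mechanisms lie in an interval
`[r, r * exp ε]` with `exp (-ε) ≤ r ≤ 1`. -/
theorem exists_peelStep_ratio (hc : ∀ o, 0 < c o) (hc' : ∀ o, 0 < c' o) {ε : ℝ}
    (hcc : (∀ o, c' o ≤ c o ∧ c o ≤ Real.exp ε * c' o) ∨
      (∀ o, c o ≤ c' o ∧ c' o ≤ Real.exp ε * c o)) (D : Finset (Fin d)) :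
    ∃ r ∈ Set.Icc (Real.exp (-ε)) 1, ∀ o, r * peelStep c' D o ≤ peelStep c D o ∧
      peelStep c D o ≤ r * Real.exp ε * peelStep c' D o := by
  have hZ : ∀ b : Option (Fin d) → ℝ, (∀ o, 0 < b o) → 0 < b none + ∑ j ∈ D, b (some j) :=
    fun b hb => add_pos_of_pos_of_nonneg (hb none) (Finset.sum_nonneg fun _ _ => (hb _).le)
  have hle : ∀ (b b' : Option (Fin d) → ℝ) (s : ℝ), (∀ o, b o ≤ s * b' o) →
      b none + ∑ j ∈ D, b (some j) ≤ s * (b' none + ∑ j ∈ D, b' (some j)) := fun b b' s hb => by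
    rw [mul_add, Finset.mul_sum]
    exact add_le_add (hb none) (Finset.sum_le_sum fun _ _ => hb _)
  have hE := Real.exp_pos ε
  have h1 := hZ c hc
  have h2 := hZ c' hc'
  simp only [peelStep]
  rcases hcc with hcc | hcc
  · have h3 := hle c' c 1 (fun o => by simpa using (hcc o).1)
    have h4 := hle c c' _ (fun o => (hcc o).2)
    generalize c none + ∑ j ∈ D, c (some j) = Z at *
    generalize c' none + ∑ j ∈ D, c' (some j) = Z' at *
    refine ⟨Z' / Z, ⟨?_, ?_⟩, fun o => ?_⟩
    · rw [Real.exp_neg, le_div_iff₀ h1, inv_mul_le_iff₀ hE]; exact h4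
    · rw [div_le_one h1]; linarith
    · have h5 : Z' / Z * (c' o / Z') = c' o / Z := by field_simp
      have h6 : Z' / Z * Real.exp ε * (c' o / Z') = (Real.exp ε * c' o) / Z := by field_simp
      rw [h5, h6]
      exact ⟨div_le_div_of_nonneg_right (hcc o).1 h1.le,
        div_le_div_of_nonneg_right (hcc o).2 h1.le⟩
  · have h3 := hle c c' 1 (fun o => by simpa using (hcc o).1)
    have h4 := hle c' c _ (fun o => (hcc o).2)
    generalize c none + ∑ j ∈ D, c (some j) = Z at *
    generalize c' none + ∑ j ∈ D, c' (some j) = Z' at *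
    refine ⟨Z' / Z * Real.exp (-ε), ⟨?_, ?_⟩, fun o => ?_⟩
    · refine le_mul_of_one_le_left (Real.exp_pos _).le ?_
      rw [one_le_div h1]; linarith
    · rw [Real.exp_neg, ← div_eq_mul_inv, div_le_one hE, div_le_iff₀ h1]; exact h4
    · have h5 : Z' / Z * Real.exp (-ε) * (c' o / Z') = ((Real.exp ε)⁻¹ * c' o) / Z := by
        rw [Real.exp_neg]; field_simp
      have h6 : Z' / Z * Real.exp (-ε) * Real.exp ε * (c' o / Z') = c' o / Z := by
        rw [Real.exp_neg]; field_simp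
      rw [h5, h6]
      exact ⟨div_le_div_of_nonneg_right ((inv_mul_le_iff₀ hE).2 (hcc o).2) h1.le,
        div_le_div_of_nonneg_right (hcc o).1 h1.le⟩

theorem peelProb_le_exp_mul (hc : ∀ o, 0 < c o) (hc' : ∀ o, 0 < c' o) {ε : ℝ}
    (hε : 0 ≤ ε) (hcc : (∀ o, c' o ≤ c o ∧ c o ≤ Real.exp ε * c' o) ∨
      (∀ o, c o ≤ c' o ∧ c' o ≤ Real.exp ε * c o)) (k : ℕ) (D : Finset (Fin d))
    (l : List (Option (Fin d))) :
    peelProb c k D l ≤ Real.exp (k * ε) * peelProb c' k D l := by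
  have hstep : ∀ D o, peelStep c D o ≤ Real.exp ε * peelStep c' D o := fun D o => by
    obtain ⟨r, hr, h⟩ := exists_peelStep_ratio hc hc' hcc D
    refine (h o).2.trans (mul_le_mul_of_nonneg_right ?_ (peelStep_pos hc' D o).le)
    exact mul_le_of_le_one_left (Real.exp_pos _).le hr.2
  induction k generalizing D l with
  | zero => simp [peelProb]
  | succ k ih =>
    have hk : Real.exp ((k + 1 : ℕ) * ε) = Real.exp ε * Real.exp (k * ε) := by
      rw [← Real.exp_add]; push_cast; ring_nf
    rcases l with _ | ⟨_ | i, _ | ⟨o, l⟩⟩ <;> simp only [peelProb, mul_zero, le_refl]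
    · refine (hstep D none).trans ?_
      gcongr
      · exact (peelStep_pos hc' D _).le
      · push_cast
        nlinarith [mul_nonneg k.cast_nonneg hε]
    all_goals
      split
      · rw [hk, mul_mul_mul_comm]
        exact mul_le_mul (hstep D _) (ih _ _) (peelProb_nonneg hc _ _ _)
          (mul_nonneg (Real.exp_pos _).le (peelStep_pos hc' D _).le)
      · simp

theorem sum_peelStep_mul_rpow_le (hc : ∀ o, 0 < c o) (hc' : ∀ o, 0 < c' o) {ε : ℝ}
    (hε : 0 < ε) (hcc : (∀ o, c' o ≤ c o ∧ c o ≤ Real.exp ε * c' o) ∨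
      (∀ o, c o ≤ c' o ∧ c' o ≤ Real.exp ε * c o)) {t : ℝ} (ht : 0 ≤ t) (D : Finset (Fin d)) :
    peelStep c D none * (peelStep c D none / peelStep c' D none) ^ t +
      ∑ i ∈ D, peelStep c D (some i) * (peelStep c D (some i) / peelStep c' D (some i)) ^ t ≤
    Real.exp (t * (ε * ((Real.exp ε - 1) / (Real.exp ε + 1))) + t ^ 2 * ε ^ 2 / 8) := by
  obtain ⟨r, hr, h⟩ := exists_peelStep_ratio hc hc' hcc D
  have hsum : ∀ F : Option (Fin d) → ℝ,
      ∑ o : Option D, F (o.map Subtype.val) = F none + ∑ i ∈ D, F (some i) := fun F => by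
    rw [Fintype.sum_option, ← Finset.sum_coe_sort D]
    rfl
  have := sum_mul_rpow_ratio_le (fun o : Option D => peelStep c D (o.map Subtype.val))
    (fun o : Option D => peelStep c' D (o.map Subtype.val))
    (fun _ => peelStep_pos hc D _) (fun _ => peelStep_pos hc' D _)
    ((hsum _).trans (peelStep_none_add_sum hc D)) ((hsum _).trans (peelStep_none_add_sum hc' D))
    hε hr (fun _ => h _) ht
  rwa [hsum fun o => peelStep c D o * (peelStep c D o / peelStep c' D o) ^ t] at this

theorem sum_peelProb_mul_rpow_le (hc : ∀ o, 0 < c o) (hc' : ∀ o, 0 < c' o) {ε : ℝ}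
    (hε : 0 < ε) (hcc : (∀ o, c' o ≤ c o ∧ c o ≤ Real.exp ε * c' o) ∨
      (∀ o, c o ≤ c' o ∧ c' o ≤ Real.exp ε * c o)) {t : ℝ} (ht : 0 ≤ t) (k : ℕ)
    (D : Finset (Fin d)) :
    ∑ l ∈ peelOutcomes d k, peelProb c k D l * (peelProb c k D l / peelProb c' k D l) ^ t ≤
    Real.exp (k * (t * (ε * ((Real.exp ε - 1) / (Real.exp ε + 1))) + t ^ 2 * ε ^ 2 / 8)) := by
  have hA : 0 ≤ t * (ε * ((Real.exp ε - 1) / (Real.exp ε + 1))) + t ^ 2 * ε ^ 2 / 8 := by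
    have : 0 ≤ Real.exp ε - 1 := sub_nonneg.2 (Real.one_le_exp hε.le)
    positivity
  have hstep := sum_peelStep_mul_rpow_le hc hc' hε hcc ht
  generalize t * (ε * ((Real.exp ε - 1) / (Real.exp ε + 1))) + t ^ 2 * ε ^ 2 / 8 = A at *
  induction k generalizing D with
  | zero => simp [peelOutcomes, peelProb]
  | succ k ih =>
    have hone : (1 : ℝ) ≤ Real.exp (k * A) := Real.one_le_exp (by positivity)
    rw [sum_peelOutcomes_succ_mul]
    calc _ ≤ (peelStep c D none * (peelStep c D none / peelStep c' D none) ^ t) *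
              Real.exp (k * A) +
            ∑ i ∈ D, (peelStep c D (some i) *
              (peelStep c D (some i) / peelStep c' D (some i)) ^ t) * Real.exp (k * A) := by
          have hR : ∀ o, 0 ≤ peelStep c D o / peelStep c' D o := fun o =>
            (div_pos (peelStep_pos hc D o) (peelStep_pos hc' D o)).le
          refine add_le_add ?_ (Finset.sum_le_sum fun i hi => ?_)
          · simp only [peelProb]
            exact le_mul_of_one_le_right
              (mul_nonneg (peelStep_pos hc D _).le (Real.rpow_nonneg (hR _) _)) hone
          · rw [mul_assoc]
            refine mul_le_mul_of_nonneg_left ?_ (peelStep_pos hc D _).le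
            refine le_trans (le_of_eq ?_)
              (mul_le_mul_of_nonneg_left (ih (D.erase i)) (Real.rpow_nonneg (hR _) t))
            rw [Finset.mul_sum]
            refine Finset.sum_congr rfl fun l _ => ?_
            simp only [peelProb, hi, if_true]
            rw [mul_div_mul_comm, Real.mul_rpow (hR _) (div_nonneg (peelProb_nonneg hc _ _ _)
              (peelProb_nonneg hc' _ _ _))]
            ring
      _ ≤ Real.exp A * Real.exp (k * A) := by
          rw [← Finset.sum_mul, ← add_mul]
          exact mul_le_mul_of_nonneg_right (hstep D) (Real.exp_pos _).le
      _ = _ := by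
          rw [← Real.exp_add]; push_cast; ring_nf

theorem sum_peelProb_le_exp_mul_add (hc : ∀ o, 0 < c o) (hc' : ∀ o, 0 < c' o) {ε : ℝ}
    (hε : 0 < ε) (hcc : (∀ o, c' o ≤ c o ∧ c o ≤ Real.exp ε * c' o) ∨
      (∀ o, c o ≤ c' o ∧ c' o ≤ Real.exp ε * c o)) {k : ℕ} (hk : 0 < k) (D : Finset (Fin d))
    {δ' : ℝ} (hδ' : δ' ∈ Set.Ioo (0 : ℝ) 1) {T : Finset (List (Option (Fin d)))}
    (hT : T ⊆ peelOutcomes d k) :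
    ∑ l ∈ T, peelProb c k D l ≤
      Real.exp (k * ε * ((Real.exp ε - 1) / (Real.exp ε + 1)) +
        ε * Real.sqrt ((k / 2) * Real.log (1 / δ'))) * ∑ l ∈ T, peelProb c' k D l + δ' := by
  have hk0 : (0 : ℝ) < k := Nat.cast_pos.2 hk
  have hlog : 0 ≤ Real.log (1 / δ') := Real.log_nonneg (by
    rw [le_div_iff₀ hδ'.1]; linarith [hδ'.2])
  set μ := ε * ((Real.exp ε - 1) / (Real.exp ε + 1)) with hμ
  set s := Real.sqrt ((k / 2) * Real.log (1 / δ')) with hs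
  have hs0 : 0 ≤ s := Real.sqrt_nonneg _
  have hs2 : s ^ 2 = (k / 2) * Real.log (1 / δ') := Real.sq_sqrt (by positivity)
  set t := 4 * s / (k * ε) with ht
  have ht0 : 0 ≤ t := by positivity
  rw [mul_assoc, ← hμ]
  set a := k * μ + ε * s with ha
  have hmgf := sum_peelProb_mul_rpow_le hc hc' hε hcc ht0 k D
  have hexp : k * (t * μ + t ^ 2 * ε ^ 2 / 8) = Real.log δ' + t * a := by
    have : Real.log δ' = -(2 / k * s ^ 2) := by
      rw [hs2, one_div, Real.log_inv]; field_simp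
    rw [this, ha, ht]
    field_simp
    ring
  rw [← hμ, hexp, Real.exp_add, Real.exp_log hδ'.1] at hmgf
  have hpt : ∀ l, peelProb c k D l ≤ Real.exp a * peelProb c' k D l +
      Real.exp (-(t * a)) *
        (peelProb c k D l * (peelProb c k D l / peelProb c' k D l) ^ t) := fun l => by
    have hP := peelProb_nonneg hc k D l
    have hQ := peelProb_nonneg hc' k D l
    rcases hQ.eq_or_lt with h0 | hQ
    · simp [peelProb_eq_zero_of_eq_zero (c := c) hc' h0.symm, ← h0]
    · have hR := div_nonneg hP hQ.le
      rcases le_total (peelProb c k D l) (Real.exp a * peelProb c' k D l) with hle | hle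
      · exact hle.trans (le_add_of_nonneg_right
          (mul_nonneg (Real.exp_pos _).le (mul_nonneg hP (Real.rpow_nonneg hR _))))
      · refine le_trans ?_ (le_add_of_nonneg_left (mul_nonneg (Real.exp_pos _).le hQ.le))
        rw [mul_left_comm]
        refine le_mul_of_one_le_right hP ?_
        have h1 := Real.rpow_le_rpow (Real.exp_pos a).le ((le_div_iff₀ hQ).2 hle) ht0
        rw [← Real.exp_mul, mul_comm a t] at h1
        rw [Real.exp_neg, ← div_eq_inv_mul, one_le_div (Real.exp_pos _)]
        exact h1
  calc ∑ l ∈ T, peelProb c k D l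
      ≤ Real.exp a * ∑ l ∈ T, peelProb c' k D l + Real.exp (-(t * a)) *
        ∑ l ∈ T, peelProb c k D l * (peelProb c k D l / peelProb c' k D l) ^ t := by
        rw [Finset.mul_sum, Finset.mul_sum, ← Finset.sum_add_distrib]
        exact Finset.sum_le_sum fun l _ => hpt l
    _ ≤ Real.exp a * ∑ l ∈ T, peelProb c' k D l + Real.exp (-(t * a)) *
          (δ' * Real.exp (t * a)) := by
        gcongr
        refine (Finset.sum_le_sum_of_subset_of_nonneg hT fun l _ _ => ?_).trans hmgf
        exact mul_nonneg (peelProb_nonneg hc _ _ _) (Real.rpow_nonneg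
          (div_nonneg (peelProb_nonneg hc _ _ _) (peelProb_nonneg hc' _ _ _)) _)
    _ = _ := by
        rw [mul_left_comm, ← Real.exp_add, neg_add_cancel, Real.exp_zero, mul_one]

end Peeling

section Histogram

variable {d : ℕ}

theorem le_kthLargest_iff {h : Fin d → ℕ} {k v : ℕ} (hk : 1 ≤ k) (hkd : k ≤ d) :
    v ≤ kthLargest h k ↔ k ≤ (Finset.univ.filter fun i => v ≤ h i).card := by
  set A := {v | k ≤ (Finset.univ.filter fun i => v ≤ h i).card} with hA
  have hne : A.Nonempty := ⟨0, by simpa [hA] using hkd⟩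
  have hbdd : BddAbove A := by
    refine ⟨∑ i, h i, fun v hv => ?_⟩
    obtain ⟨i, hi⟩ := Finset.card_pos.1 (hk.trans hv)
    exact (Finset.mem_filter.1 hi).2.trans
      (Finset.single_le_sum (f := h) (fun _ _ => Nat.zero_le _) (Finset.mem_univ i))
  constructor
  · intro hv
    have hmem : k ≤ (Finset.univ.filter fun i => kthLargest h k ≤ h i).card :=
      Nat.sSup_mem hne hbdd
    exact hmem.trans (Finset.card_le_card
      (Finset.monotone_filter_right _ fun i _ hi => hv.trans hi))
  · exact fun hv => le_csSup hbdd hv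

theorem kthLargest_le_of_le {h h' : Fin d → ℕ} {k n : ℕ} (hk : 1 ≤ k) (hkd : k ≤ d)
    (hh : ∀ i, h i ≤ h' i + n) : kthLargest h k ≤ kthLargest h' k + n := by
  rw [← tsub_le_iff_right, le_kthLargest_iff hk hkd]
  refine ((le_kthLargest_iff (h := h) hk hkd).1 le_rfl).trans (Finset.card_le_card
    (Finset.monotone_filter_right _ fun i _ hi => ?_))
  exact tsub_le_iff_right.2 (hi.trans (hh i))

theorem histRank_lt_histRank {h : Fin d → ℕ} {i j : Fin d}
    (hij : h i < h j ∨ (h j = h i ∧ j < i)) : histRank h j < histRank h i := by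
  refine Finset.card_lt_card ((Finset.ssubset_iff_of_subset fun m hm => ?_).2 ⟨j, ?_, ?_⟩)
  · simp only [Finset.mem_filter, Finset.mem_univ, true_and] at hm ⊢
    omega
  · simpa using hij
  · simp

theorem beats_of_histRank_lt {h : Fin d → ℕ} {i j : Fin d} (hij : histRank h j < histRank h i) :
    h i < h j ∨ (h j = h i ∧ j < i) := by
  by_contra hcon
  rcases eq_or_ne i j with rfl | hne
  · exact lt_irrefl _ hij
  · exact (histRank_lt_histRank (h := h) (i := j) (j := i) (by omega)).not_gt hij

theorem histRank_injective (h : Fin d → ℕ) : Function.Injective (histRank h) := by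
  intro i j hij
  by_contra hne
  have : (h i < h j ∨ (h j = h i ∧ j < i)) ∨ (h j < h i ∨ (h i = h j ∧ i < j)) := by omega
  rcases this with h1 | h1
  · exact (histRank_lt_histRank h1).ne hij.symm
  · exact (histRank_lt_histRank h1).ne hij

theorem histRank_lt (h : Fin d → ℕ) (i : Fin d) : histRank h i < d := by
  have : histRank h i < (Finset.univ : Finset (Fin d)).card :=
    Finset.card_lt_card (Finset.filter_ssubset.2 ⟨i, Finset.mem_univ i, by simp⟩)
  simpa using this

theorem card_limitedDomain (h : Fin d → ℕ) {k : ℕ} (hk : k ≤ d) :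
    (limitedDomain h k).card = k := by
  have himage : Finset.univ.image (histRank h) = Finset.range d :=
    Finset.eq_of_subset_of_card_le (fun n hn => by
      obtain ⟨i, _, rfl⟩ := Finset.mem_image.1 hn
      exact Finset.mem_range.2 (histRank_lt h i))
      (by rw [Finset.card_image_of_injective _ (histRank_injective h)]; simp)
  have himage' : (limitedDomain h k).image (histRank h) = Finset.range k := by
    ext n
    simp only [limitedDomain, Finset.mem_image, Finset.mem_filter, Finset.mem_univ, true_and,
      Finset.mem_range]
    constructor
    · rintro ⟨i, hi, rfl⟩
      exact hi
    · intro hn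
      have := Finset.mem_range.2 (hn.trans_le hk)
      rw [← himage] at this
      obtain ⟨i, _, rfl⟩ := Finset.mem_image.1 this
      exact ⟨i, hn, rfl⟩
  rw [← Finset.card_image_of_injective _ (histRank_injective h), himage', Finset.card_range]

theorem beats_of_mem_limitedDomain {h : Fin d → ℕ} {k : ℕ} {i j : Fin d}
    (hi : i ∈ limitedDomain h k) (hj : j ∉ limitedDomain h k) :
    h j < h i ∨ (h i = h j ∧ i < j) := by
  simp only [limitedDomain, Finset.mem_filter, Finset.mem_univ, true_and, not_lt] at hi hj
  exact beats_of_histRank_lt (hi.trans_le hj)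

theorem le_kthLargest_of_notMem_limitedDomain {h : Fin d → ℕ} {k : ℕ} (hk : k < d) {j : Fin d}
    (hj : j ∉ limitedDomain h k) : h j ≤ kthLargest h (k + 1) := by
  rw [le_kthLargest_iff (by omega) hk]
  simp only [limitedDomain, Finset.mem_filter, Finset.mem_univ, true_and, not_lt] at hj
  refine Nat.succ_le_of_lt (hj.trans_lt (Finset.card_lt_card
    ((Finset.ssubset_iff_of_subset fun m hm => ?_).2 ⟨j, ?_, ?_⟩)))
  · simp only [Finset.mem_filter, Finset.mem_univ, true_and] at hm ⊢
    omega
  · simp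
  · simp

/-- A map identifying two finite sets of equal cardinality and fixing their intersection. -/
theorem exists_map_fixing_inter {α : Type*} [DecidableEq α] {D D' : Finset α}
    (hcard : D.card = D'.card) :
    ∃ σ : α → α, Set.InjOn σ D ∧ D.image σ = D' ∧
      ∀ i, σ i = i ∨ (i ∈ D ∧ i ∉ D' ∧ σ i ∈ D' ∧ σ i ∉ D) := by
  have hsdiff : (D \ D').card = (D' \ D).card := Finset.card_sdiff_comm hcard
  let e := Finset.equivOfCardEq hsdiff
  have hmem : ∀ x, (e x : α) ∈ D' ∧ (e x : α) ∉ D := fun x => Finset.mem_sdiff.1 (e x).2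
  let σ : α → α := fun i => if hi : i ∈ D \ D' then e ⟨i, hi⟩ else i
  have hσ : ∀ i (hi : i ∈ D \ D'), σ i = e ⟨i, hi⟩ := fun i hi => dif_pos hi
  have hσ' : ∀ i, i ∉ D \ D' → σ i = i := fun i hi => dif_neg hi
  have hinj : Set.InjOn σ D := by
    intro i hi j hj hij
    by_cases hi' : i ∈ D \ D' <;> by_cases hj' : j ∈ D \ D'
    · rw [hσ i hi', hσ j hj'] at hij
      simpa using e.injective (Subtype.ext hij)
    · rw [hσ i hi', hσ' j hj'] at hij
      exact absurd (hij ▸ hj) (hmem _).2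
    · rw [hσ' i hi', hσ j hj'] at hij
      exact absurd (hij ▸ hi) (hmem _).2
    · rwa [hσ' i hi', hσ' j hj'] at hij
  refine ⟨σ, hinj, Finset.eq_of_subset_of_card_le (fun m hm => ?_) ?_, fun i => ?_⟩
  · obtain ⟨i, hi, rfl⟩ := Finset.mem_image.1 hm
    by_cases hi' : i ∈ D \ D'
    · rw [hσ i hi']
      exact (hmem _).1
    · rw [hσ' i hi']
      simp_all
  · rw [Finset.card_image_of_injOn hinj, hcard]
  · by_cases hi' : i ∈ D \ D'
    · right
      rw [hσ i hi']
      exact ⟨(Finset.mem_sdiff.1 hi').1, (Finset.mem_sdiff.1 hi').2, hmem _⟩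
    · exact Or.inl (hσ' i hi')

theorem emWeight_pos (ε δ : ℝ) (Δ kbar : ℕ) (h : Fin d → ℕ) (o : Option (Fin d)) :
    0 < emWeight ε δ Δ kbar h o := by
  cases o <;> exact Real.exp_pos _

theorem emWeight_le_emWeight_map {ε : ℝ} (hε : 0 ≤ ε) (δ : ℝ) (Δ : ℕ) {kbar : ℕ} (hkd : kbar < d)
    {h h' : Fin d → ℕ} {σ : Fin d → Fin d} {n : ℕ} (hh : ∀ i, h i ≤ h' i + n)
    (hσ : ∀ i, h i ≤ h' (σ i) + n) (o : Option (Fin d)) :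
    emWeight ε δ Δ kbar h o ≤ Real.exp (n * ε) * emWeight ε δ Δ kbar h' (o.map σ) := by
  cases o with
  | none =>
    have h1 : (kthLargest h (kbar + 1) : ℝ) ≤ kthLargest h' (kbar + 1) + n := by
      exact_mod_cast kthLargest_le_of_le (by omega) hkd hh
    simp only [emWeight, Option.map_none, hBot]
    rw [← Real.exp_add]
    gcongr
    nlinarith
  | some i =>
    have h1 : (h i : ℝ) ≤ h' (σ i) + n := by exact_mod_cast hσ i
    simp only [emWeight, Option.map_some]
    rw [← Real.exp_add]
    gcongr
    nlinarith

theorem emWeight_map_le_emWeight {ε : ℝ} (hε : 0 ≤ ε) (δ : ℝ) (Δ : ℕ) {kbar : ℕ} (hkd : kbar < d)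
    {h h' : Fin d → ℕ} {σ : Fin d → Fin d} {n : ℕ} (hh : ∀ i, h' i ≤ h i + n)
    (hσ : ∀ i, h' (σ i) ≤ h i + n) (o : Option (Fin d)) :
    emWeight ε δ Δ kbar h' (o.map σ) ≤ Real.exp (n * ε) * emWeight ε δ Δ kbar h o := by
  cases o with
  | none =>
    have h1 : (kthLargest h' (kbar + 1) : ℝ) ≤ kthLargest h (kbar + 1) + n := by
      exact_mod_cast kthLargest_le_of_le (by omega) hkd hh
    simp only [emWeight, Option.map_none, hBot]
    rw [← Real.exp_add]
    gcongr
    nlinarith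
  | some i =>
    have h1 : (h' (σ i) : ℝ) ≤ h i + n := by exact_mod_cast hσ i
    simp only [emWeight, Option.map_some]
    rw [← Real.exp_add]
    gcongr
    nlinarith

/-- Indices whose count exceeds `h_{(k̄+1)}` by at most one have total weight at most
`δ` times that of `⊥`. -/
theorem sum_emWeight_div_le {ε δ : ℝ} (hε : 0 < ε) (hδ : 0 < δ) {Δ kbar : ℕ} {h : Fin d → ℕ}
    {B : Finset (Fin d)} (hB : B.card ≤ min Δ kbar)
    (hle : ∀ i ∈ B, h i ≤ kthLargest h (kbar + 1) + 1) :
    (∑ i ∈ B, emWeight ε δ Δ kbar h (some i)) / emWeight ε δ Δ kbar h none ≤ δ := by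
  rcases Nat.eq_zero_or_pos (min Δ kbar) with h0 | hpos
  · have : B = ∅ := Finset.card_eq_zero.1 (by omega)
    simpa [this] using hδ.le
  · have hm : (0 : ℝ) < (min Δ kbar : ℕ) := Nat.cast_pos.2 hpos
    rw [div_le_iff₀ (emWeight_pos _ _ _ _ _ _)]
    have hbot : δ * emWeight ε δ Δ kbar h none =
        (min Δ kbar : ℕ) * Real.exp (ε * (kthLargest h (kbar + 1) + 1)) := by
      simp only [emWeight, hBot]
      rw [mul_add, mul_div_cancel₀ _ hε.ne', Real.exp_add, Real.exp_log (by positivity)]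
      field_simp
    rw [hbot]
    calc _ ≤ ∑ _i ∈ B, Real.exp (ε * (kthLargest h (kbar + 1) + 1)) := by
          refine Finset.sum_le_sum fun i hi => ?_
          have : (h i : ℝ) ≤ kthLargest h (kbar + 1) + 1 := by exact_mod_cast hle i hi
          simp only [emWeight]
          gcongr
      _ = B.card * Real.exp (ε * (kthLargest h (kbar + 1) + 1)) := by simp
      _ ≤ _ := by gcongr

/-- Identification of the limited domains of two restricted neighbors, along which the counts
remain neighboring. -/
theorem exists_limitedDomain_map {Δ kbar : ℕ} (hkd : kbar < d) {h h' : Fin d → ℕ}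
    (hnb : RestrictedNeighbors Δ h h') :
    ∃ σ : Fin d → Fin d, Set.InjOn σ (limitedDomain h kbar) ∧
      (limitedDomain h kbar).image σ = limitedDomain h' kbar ∧
      ((∀ i, (h' i ≤ h i ∧ h i ≤ h' i + 1) ∧ h' (σ i) ≤ h i ∧ h i ≤ h' (σ i) + 1) ∨
        (∀ i, (h i ≤ h' i ∧ h' i ≤ h i + 1) ∧ h i ≤ h' (σ i) ∧ h' (σ i) ≤ h i + 1)) ∧
      ((limitedDomain h kbar).filter fun i => σ i ≠ i).card ≤ min Δ kbar ∧
      ∀ i ∈ (limitedDomain h kbar).filter (fun i => σ i ≠ i),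
        h i ≤ kthLargest h (kbar + 1) + 1 := by
  obtain ⟨hn, hΔ⟩ := hnb
  obtain ⟨σ, hinj, himage, hσ⟩ := exists_map_fixing_inter
    ((card_limitedDomain h hkd.le).trans (card_limitedDomain h' hkd.le).symm)
  have hmove : ∀ i, σ i ≠ i → i ∈ limitedDomain h kbar ∧
      (h (σ i) < h i ∨ (h i = h (σ i) ∧ i < σ i)) ∧
      (h' i < h' (σ i) ∨ (h' (σ i) = h' i ∧ σ i < i)) ∧
      h (σ i) ≤ kthLargest h (kbar + 1) := fun i hi => by
    obtain ⟨h1, h2, h3, h4⟩ := (hσ i).resolve_left hi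
    exact ⟨h1, beats_of_mem_limitedDomain h1 h4, beats_of_mem_limitedDomain h3 h2,
      le_kthLargest_of_notMem_limitedDomain hkd h4⟩
  refine ⟨σ, hinj, himage, ?_, le_min ?_ ?_, ?_⟩
  · rcases hn with hn | hn
    · refine Or.inl fun i => ⟨hn i, ?_⟩
      by_cases hi : σ i = i
      · rw [hi]; exact hn i
      · have h1 := hmove i hi
        have h2 := hn i
        have h3 := hn (σ i)
        omega
    · refine Or.inr fun i => ⟨hn i, ?_⟩
      by_cases hi : σ i = i
      · rw [hi]; exact hn i
      · have h1 := hmove i hi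
        have h2 := hn i
        have h3 := hn (σ i)
        omega
  · refine le_trans ?_ hΔ
    rcases hn with hn | hn
    · refine Finset.card_le_card fun i hi => ?_
      have h1 := hmove i (Finset.mem_filter.1 hi).2
      have h2 := hn i
      have h3 := hn (σ i)
      simp only [Finset.mem_filter, Finset.mem_univ, true_and]
      omega
    · refine Finset.card_le_card_of_injOn σ (fun i hi => ?_)
        (hinj.mono (Finset.coe_subset.2 (Finset.filter_subset _ _)))
      have h1 := hmove i (Finset.mem_filter.1 hi).2
      have h2 := hn i
      have h3 := hn (σ i)
      simp only [Finset.coe_filter, Set.mem_ofPred_eq, Finset.mem_univ, true_and]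
      omega
  · exact (Finset.card_filter_le _ _).trans (card_limitedDomain h hkd.le).le
  · intro i hi
    have h1 := hmove i (Finset.mem_filter.1 hi).2
    have h2 := hn.imp (fun hn => (⟨hn i, hn (σ i)⟩ : _ ∧ _))
      (fun hn => (⟨hn i, hn (σ i)⟩ : _ ∧ _))
    omega

end Histogram

theorem tsum_prEMProb {d : ℕ} (ε δ : ℝ) (Δ kbar : ℕ) (h : Fin d → ℕ) (k : ℕ)
    (D : Finset (Fin d)) (S : Set (List (Option (Fin d)))) [DecidablePred (· ∈ S)] :
    ∑' l : S, prEMProb ε δ Δ kbar h k D (l : List (Option (Fin d))) =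
      ∑ l ∈ (peelOutcomes d k).filter (· ∈ S), peelProb (emWeight ε δ Δ kbar h) k D l := by
  simp only [prEMProb_eq_peelProb]
  rw [tsum_subtype S, tsum_eq_sum (s := peelOutcomes d k), Finset.sum_filter]
  · simp only [Set.indicator_apply]
  · intro l hl
    simp [Set.indicator_apply, peelProb_eq_zero_of_notMem hl]

/-- The peeling mechanism with two likelihood-close weight functions on a common domain. -/
theorem sum_peelProb_le_exp_min {d : ℕ} {c c' : Option (Fin d) → ℝ} (hc : ∀ o, 0 < c o)
    (hc' : ∀ o, 0 < c' o) {ε : ℝ}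
    (hε : 0 < ε) (hcc : (∀ o, c' o ≤ c o ∧ c o ≤ Real.exp ε * c' o) ∨
      (∀ o, c o ≤ c' o ∧ c' o ≤ Real.exp ε * c o)) (k : ℕ) (D : Finset (Fin d))
    {δ' : ℝ} (hδ' : δ' ∈ Set.Ioo (0 : ℝ) 1) {T : Finset (List (Option (Fin d)))}
    (hT : T ⊆ peelOutcomes d k) :
    ∑ l ∈ T, peelProb c k D l ≤
      Real.exp (min ((k : ℝ) * ε)
          (min ((k : ℝ) * ε * ((Real.exp ε - 1) / (Real.exp ε + 1)) +
                ε * Real.sqrt (2 * (k : ℝ) * Real.log (1 / δ')))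
               ((k : ℝ) * ε ^ 2 / 2 +
                ε * Real.sqrt (((k : ℝ) / 2) * Real.log (1 / δ'))))) *
        ∑ l ∈ T, peelProb c' k D l + δ' := by
  have hlog : 0 ≤ Real.log (1 / δ') := Real.log_nonneg (by
    rw [le_div_iff₀ hδ'.1]; linarith [hδ'.2])
  have hQ : 0 ≤ ∑ l ∈ T, peelProb c' k D l :=
    Finset.sum_nonneg fun l _ => peelProb_nonneg hc' _ _ _
  have hpure : ∑ l ∈ T, peelProb c k D l ≤
      Real.exp (k * ε) * ∑ l ∈ T, peelProb c' k D l + δ' := by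
    refine le_add_of_le_of_nonneg ?_ hδ'.1.le
    rw [Finset.mul_sum]
    exact Finset.sum_le_sum fun l _ => peelProb_le_exp_mul hc hc' hε.le hcc k D l
  rcases Nat.eq_zero_or_pos k with rfl | hk
  · simpa using hpure
  have happrox := sum_peelProb_le_exp_mul_add hc hc' hε hcc hk D hδ' hT
  have hmono : ∀ {a b : ℝ}, a ≤ b → Real.exp a * ∑ l ∈ T, peelProb c' k D l + δ' ≤
      Real.exp b * ∑ l ∈ T, peelProb c' k D l + δ' := fun hab => by gcongr
  refine min_rec' (fun x => ∑ l ∈ T, peelProb c k D l ≤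
    Real.exp x * ∑ l ∈ T, peelProb c' k D l + δ') hpure
    (min_rec' (fun x => ∑ l ∈ T, peelProb c k D l ≤
      Real.exp x * ∑ l ∈ T, peelProb c' k D l + δ') ?_ ?_)
  · refine happrox.trans (hmono ?_)
    gcongr
    linarith [k.cast_nonneg (α := ℝ)]
  · refine happrox.trans (hmono ?_)
    gcongr
    have := mul_le_mul_of_nonneg_left (exp_sub_one_div_exp_add_one_le hε)
      (by positivity : (0 : ℝ) ≤ k * ε)
    linarith

/-- Theorem 1 / Lemma 14: the limited-domain Gumbel-noise top-`k` mechanism (Algorithm 1),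
equivalently the peeling mechanism `prEM_{k,k̄}(·, D_{k̄}(·))`, is `(ε', δ + δ')`-differentially
private, where
`ε' = min{kε, kε(e^ε−1)/(e^ε+1) + ε√(2k ln(1/δ')), kε²/2 + ε√((k/2) ln(1/δ'))}`. -/
theorem stmt_11 (d : ℕ) (ε δ : ℝ) (hε : 0 < ε) (hδ : 0 < δ) (δ' : ℝ) (hδ' : δ' ∈ Set.Ioo (0:ℝ) 1)
    (Δ : ℕ) (hΔ : 1 ≤ Δ) (k kbar : ℕ) (hkk : k ≤ kbar) (hkd : kbar < d)
    (h h' : Fin d → ℕ) (hnb : RestrictedNeighbors Δ h h')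
    (S : Set (List (Option (Fin d)))) :
    ∑' l : S, prEMProb ε δ Δ kbar h k (limitedDomain h kbar) (l : List (Option (Fin d))) ≤
      Real.exp (min ((k : ℝ) * ε)
          (min ((k : ℝ) * ε * ((Real.exp ε - 1) / (Real.exp ε + 1)) +
                ε * Real.sqrt (2 * (k : ℝ) * Real.log (1 / δ')))
               ((k : ℝ) * ε ^ 2 / 2 +
                ε * Real.sqrt (((k : ℝ) / 2) * Real.log (1 / δ'))))) *
        (∑' l : S, prEMProb ε δ Δ kbar h' k (limitedDomain h' kbar) (l : List (Option (Fin d))))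
      + δ + δ' := by
  classical
  obtain ⟨σ, hinj, himage, hclose, hcard, hlow⟩ := exists_limitedDomain_map hkd hnb
  rw [tsum_prEMProb, tsum_prEMProb]
  set D := limitedDomain h kbar
  set c := emWeight ε δ Δ kbar h
  set c' := emWeight ε δ Δ kbar h'
  have hc : ∀ o, 0 < c o := emWeight_pos ε δ Δ kbar h
  have hc' : ∀ o, 0 < c' o := emWeight_pos ε δ Δ kbar h'
  set B := D.filter fun i => σ i ≠ i
  have hcc : (∀ o, (c' ∘ Option.map σ) o ≤ c o ∧ c o ≤ Real.exp ε * (c' ∘ Option.map σ) o) ∨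
      (∀ o, c o ≤ (c' ∘ Option.map σ) o ∧ (c' ∘ Option.map σ) o ≤ Real.exp ε * c o) := by
    refine hclose.imp (fun hcl o => ⟨?_, ?_⟩) (fun hcl o => ⟨?_, ?_⟩)
    · simpa using emWeight_map_le_emWeight hε.le δ Δ hkd (n := 0) (fun i => (hcl i).1.1)
        (fun i => (hcl i).2.1) o
    · simpa using emWeight_le_emWeight_map hε.le δ Δ hkd (n := 1) (fun i => (hcl i).1.2)
        (fun i => (hcl i).2.2) o
    · simpa using emWeight_le_emWeight_map hε.le δ Δ hkd (n := 0) (fun i => (hcl i).1.1)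
        (fun i => (hcl i).2.1) o
    · simpa using emWeight_map_le_emWeight hε.le δ Δ hkd (n := 1) (fun i => (hcl i).1.2)
        (fun i => (hcl i).2.2) o
  set T := (peelOutcomes d k).filter (· ∈ S)
  have hbad : ∑ l ∈ T.filter (fun l => ∃ i ∈ B, some i ∈ l), peelProb c k D l ≤ δ :=
    (Finset.sum_le_sum_of_subset_of_nonneg
      (Finset.filter_subset_filter _ (Finset.filter_subset _ _))
      fun _ _ _ => peelProb_nonneg hc _ _ _).trans
      ((sum_peelProb_mem_le hc k D B).trans (sum_emWeight_div_le hε hδ hcard hlow))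
  have hgood := sum_peelProb_le_exp_min (c' := c' ∘ Option.map σ) hc
    (fun o => hc' (o.map σ)) hε hcc k D hδ'
    (T := T.filter (fun l => ¬ ∃ i ∈ B, some i ∈ l))
    ((Finset.filter_subset _ _).trans (Finset.filter_subset _ _))
  have hmap : ∑ l ∈ T.filter (fun l => ¬ ∃ i ∈ B, some i ∈ l),
      peelProb (c' ∘ Option.map σ) k D l ≤ ∑ l ∈ T, peelProb c' k (limitedDomain h' kbar) l := by
    refine le_trans (Finset.sum_le_sum fun l hl => ?_)
      (Finset.sum_le_sum_of_subset_of_nonneg (Finset.filter_subset _ T)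
        fun _ _ _ => peelProb_nonneg hc' _ _ _)
    rw [← himage]
    refine peelProb_comp_map_le hc' k hinj fun i hi hil => ?_
    by_contra hne
    exact (Finset.mem_filter.1 hl).2 ⟨i, Finset.mem_filter.2 ⟨hi, hne⟩, hil⟩
  rw [← Finset.sum_filter_add_sum_filter_not T (fun l => ∃ i ∈ B, some i ∈ l)]
  have := mul_le_mul_of_nonneg_left hmap (Real.exp_pos (min ((k : ℝ) * ε)
          (min ((k : ℝ) * ε * ((Real.exp ε - 1) / (Real.exp ε + 1)) +
                ε * Real.sqrt (2 * (k : ℝ) * Real.log (1 / δ')))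
               ((k : ℝ) * ε ^ 2 / 2 +
                ε * Real.sqrt (((k : ℝ) / 2) * Real.log (1 / δ')))))).le
  linarith
end

section
/- Let h, h' : Fin d → ℕ be neighboring histograms, fix k < d, ε > 0, and any T ∈ ℝ, and let L be a real random variable with Laplace density (ε/2)·e^{−ε|z|}. Then for every index i: Pr[ h(i) + L > h_{(k+1)} + T ] ≤ e^{ε} · Pr[ h'(i) + L > h'_{(k+1)} + T ]. -/
open MeasureTheory

/-- Raising every entry by at most `c` raises the `k`-th largest value by at most `c`. -/
theorem kthLargest_le_add {d k c : ℕ} {h h' : Fin d → ℕ} (hk : 0 < k) (hkd : k ≤ d)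
    (hle : ∀ i, h i ≤ h' i + c) : kthLargest h k ≤ kthLargest h' k + c := by
  have hbdd : BddAbove {v | k ≤ (Finset.univ.filter fun i => v ≤ h' i).card} := by
    refine ⟨Finset.univ.sup h', fun v hv => ?_⟩
    obtain ⟨i, hi⟩ := Finset.card_pos.mp (hk.trans_le hv)
    exact (Finset.mem_filter.mp hi).2.trans (Finset.le_sup (Finset.mem_univ i))
  refine csSup_le ⟨0, by simpa using hkd⟩ fun v hv => ?_
  suffices v - c ≤ kthLargest h' k by omega
  refine le_csSup hbdd (le_trans (Set.mem_ofPred_eq ▸ hv) (Finset.card_le_card fun i hi => ?_))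
  have hvi : v ≤ h i := (Finset.mem_filter.mp hi).2
  have hi' := hle i
  simp only [Finset.mem_filter, Finset.mem_univ, true_and]
  omega

/-- The difference between a count and the `k`-th largest count has sensitivity one. -/
theorem Neighbors.abs_sub_kthLargest_le {d k : ℕ} {h h' : Fin d → ℕ} (hnb : Neighbors h h')
    (hk : 0 < k) (hkd : k ≤ d) (i : Fin d) :
    |((kthLargest h' k : ℝ) - h' i) - ((kthLargest h k : ℝ) - h i)| ≤ 1 := by
  rw [abs_le]
  rcases hnb with H | H
  all_goals
    have h₁ := kthLargest_le_add (c := 0) hk hkd fun j => (H j).1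
    have h₂ := kthLargest_le_add (c := 1) hk hkd fun j => (H j).2
    have h₃ := (H i).1
    have h₄ := (H i).2
    rify at h₁ h₂ h₃ h₄
    constructor <;> linarith

/-- Moving the threshold of a Laplace tail by at most one costs a factor of at most `exp ε`. -/
theorem lintegral_laplace_Ioi_le {ε a b : ℝ} (hε : 0 ≤ ε) (hab : |b - a| ≤ 1) :
    ∫⁻ z in Set.Ioi a, ENNReal.ofReal ((ε / 2) * Real.exp (-(ε * |z|))) ≤
      ENNReal.ofReal (Real.exp ε) *
        ∫⁻ z in Set.Ioi b, ENNReal.ofReal ((ε / 2) * Real.exp (-(ε * |z|))) := by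
  rw [← lintegral_indicator measurableSet_Ioi, ← lintegral_indicator measurableSet_Ioi,
    ← lintegral_sub_right_eq_self _ (b - a), ← lintegral_const_mul' _ _ ENNReal.ofReal_ne_top]
  refine lintegral_mono fun z => ?_
  by_cases hz : b < z
  · rw [Set.indicator_of_mem (show z - (b - a) ∈ Set.Ioi a by
        simp only [Set.mem_Ioi]; linarith), Set.indicator_of_mem (show z ∈ Set.Ioi b from hz),
      ← ENNReal.ofReal_mul (Real.exp_pos ε).le]
    refine ENNReal.ofReal_le_ofReal ?_
    rw [mul_left_comm, ← Real.exp_add]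
    have hshift : |z| ≤ |z - (b - a)| + 1 := by
      linarith [abs_sub_abs_le_abs_sub z (b - a)]
    gcongr
    nlinarith
  · rw [Set.indicator_of_notMem (show z - (b - a) ∉ Set.Ioi a by
      simp only [Set.mem_Ioi]; linarith)]
    exact zero_le

/-- Lemma 28: reporting whether a Laplace-noised count exceeds the data-dependent threshold
`h_{(k+1)} + T` changes in probability by at most a factor `e^ε` between neighboring
histograms. -/
theorem stmt_19 {Ω : Type*} [MeasurableSpace Ω] (ℙ : Measure Ω) [IsProbabilityMeasure ℙ]
    (d : ℕ) (h h' : Fin d → ℕ) (hnb : Neighbors h h') (k : ℕ) (hkd : k < d)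
    (ε : ℝ) (hε : 0 < ε) (T : ℝ) (L : Ω → ℝ) (hL : Measurable L)
    (hlaw : Measure.map L ℙ =
      (volume : Measure ℝ).withDensity fun z => ENNReal.ofReal ((ε / 2) * Real.exp (-(ε * |z|))))
    (i : Fin d) :
    ℙ {ω | (h i : ℝ) + L ω > (kthLargest h (k + 1) : ℝ) + T} ≤
      ENNReal.ofReal (Real.exp ε) *
        ℙ {ω | (h' i : ℝ) + L ω > (kthLargest h' (k + 1) : ℝ) + T} := by
  have tail (g : Fin d → ℕ) : ℙ {ω | (g i : ℝ) + L ω > (kthLargest g (k + 1) : ℝ) + T} =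
      ∫⁻ z in Set.Ioi ((kthLargest g (k + 1) : ℝ) - g i + T),
        ENNReal.ofReal ((ε / 2) * Real.exp (-(ε * |z|))) := by
    rw [← withDensity_apply _ measurableSet_Ioi, ← hlaw, Measure.map_apply hL measurableSet_Ioi]
    congr 1
    ext ω
    simp only [Set.mem_ofPred_eq, Set.mem_preimage, Set.mem_Ioi]
    constructor <;> intro hω <;> linarith
  rw [tail h, tail h']
  refine lintegral_laplace_Ioi_le hε.le ?_
  rw [add_sub_add_right_eq_sub]
  exact hnb.abs_sub_kthLargest_le k.succ_pos hkd i
end
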